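/- arXiv:1905.11976 — 5 statements merged into one kernel-verified Lean document; each statement's English description precedes it below -/
import Mathlib

section
/- Let m, β ∈ ℝ with β ≠ 0 and let φ : ℝ² → ℝ (coordinates (x,t)) be twice continuously differentiable. Define the matrix-valued functions U(x,t;λ) = U(φ(x,t), ∂_tφ(x,t); λ) and V(x,t;λ) = V(φ(x,t), ∂_xφ(x,t); λ). Then the zero curvature equation ∂_t U(x,t;λ) − ∂_x V(x,t;λ) + [U(x,t;λ), V(x,t;λ)] = 0 holds for all (x,t) ∈ ℝ² and all λ ∈ ℂ with λ ≠ 0 if and only if φ satisfies the sine-Gordon equation ∂_t²φ − ∂_x²φ + (m²/β)·sin(βφ) = 0 on all of ℝ². -/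
noncomputable section

open Matrix

/-- Pauli matrices -/
def σ1 : Matrix (Fin 2) (Fin 2) ℂ := !![0, 1; 1, 0]
def σ2 : Matrix (Fin 2) (Fin 2) ℂ := !![0, -Complex.I; Complex.I, 0]
def σ3 : Matrix (Fin 2) (Fin 2) ℂ := !![1, 0; 0, -1]

def k0 (m : ℝ) (lam : ℂ) : ℂ := (m / 4) * (lam + lam⁻¹)
def k1 (m : ℝ) (lam : ℂ) : ℂ := (m / 4) * (lam - lam⁻¹)

/-- sine-Gordon space Lax matrix U(φ, φ_t; λ). -/
def USG (m β φ φt : ℝ) (lam : ℂ) : Matrix (Fin 2) (Fin 2) ℂ :=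
  (-Complex.I * k0 m lam * Real.sin (β * φ / 2)) • σ1
    + (-Complex.I * k1 m lam * Real.cos (β * φ / 2)) • σ2
    + (-Complex.I * (β / 4) * φt) • σ3

/-- sine-Gordon time Lax matrix V(φ, φ_x; λ). -/
def VSG (m β φ φx : ℝ) (lam : ℂ) : Matrix (Fin 2) (Fin 2) ℂ :=
  (-Complex.I * k1 m lam * Real.sin (β * φ / 2)) • σ1
    + (-Complex.I * k0 m lam * Real.cos (β * φ / 2)) • σ2
    + (-Complex.I * (β / 4) * φx) • σ3

/-- Entrywise directional derivative of a matrix-valued function on ℝ², coordinates (x,t). -/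
def mderiv (F : ℝ × ℝ → Matrix (Fin 2) (Fin 2) ℂ) (p v : ℝ × ℝ) :
    Matrix (Fin 2) (Fin 2) ℂ :=
  Matrix.of fun i j => fderiv ℝ (fun w => F w i j) p v

/-- Entrywise derivative of a Lax-type matrix. -/
lemma mderiv_lax (A B C : ℂ) (β : ℝ) (f g : ℝ × ℝ → ℝ) (p v : ℝ × ℝ)
    (hf : DifferentiableAt ℝ f p) (hg : DifferentiableAt ℝ g p) :
    mderiv (fun w => (A * Real.sin (β * f w / 2)) • σ1 + (B * Real.cos (β * f w / 2)) • σ2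
      + (C * g w) • σ3) p v
    = (A * (Real.cos (β * f p / 2) * (β / 2 * fderiv ℝ f p v))) • σ1
      + (B * (-Real.sin (β * f p / 2) * (β / 2 * fderiv ℝ f p v))) • σ2
      + (C * fderiv ℝ g p v) • σ3 := by
  have hin : HasFDerivAt (fun w => β * f w / 2) ((β / 2) • fderiv ℝ f p) p := by
    have := hf.hasFDerivAt.const_mul (β / 2)
    refine this.congr_of_eventuallyEq (Filter.Eventually.of_forall fun w => ?_)
    simp only []
    ring
  have hs := Complex.ofRealCLM.hasFDerivAt.comp p hin.sin
  have hc := Complex.ofRealCLM.hasFDerivAt.comp p hin.cos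
  have hg' := Complex.ofRealCLM.hasFDerivAt.comp p hg.hasFDerivAt
  have key : ∀ i j, HasFDerivAt (fun w => ((A * Real.sin (β * f w / 2)) • σ1
      + (B * Real.cos (β * f w / 2)) • σ2 + (C * g w) • σ3) i j) _ p := fun i j =>
    (((hs.const_mul A).mul_const (σ1 i j)).add ((hc.const_mul B).mul_const (σ2 i j))).add
      ((hg'.const_mul C).mul_const (σ3 i j))
  ext i j
  simp only [mderiv, Matrix.of_apply]
  rw [(key i j).fderiv]
  simp
  ring

lemma curv (m β : ℝ) (hβ : β ≠ 0) (φ : ℝ × ℝ → ℝ) (hφ : ContDiff ℝ 2 φ) (p : ℝ × ℝ)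
    (lam : ℂ) (hl : lam ≠ 0) :
      mderiv (fun w => USG m β (φ w) (fderiv ℝ φ w (0, 1)) lam) p (0, 1)
        - mderiv (fun w => VSG m β (φ w) (fderiv ℝ φ w (1, 0)) lam) p (1, 0)
        + (USG m β (φ p) (fderiv ℝ φ p (0, 1)) lam * VSG m β (φ p) (fderiv ℝ φ p (1, 0)) lam
            - VSG m β (φ p) (fderiv ℝ φ p (1, 0)) lam * USG m β (φ p) (fderiv ℝ φ p (0, 1)) lam)
      = (-Complex.I * (β / 4) * ((fderiv ℝ (fun w => fderiv ℝ φ w (0, 1)) p (0, 1)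
          - fderiv ℝ (fun w => fderiv ℝ φ w (1, 0)) p (1, 0)
          + (m ^ 2 / β) * Real.sin (β * φ p) : ℝ) : ℂ)) • σ3 := by
  have hd : DifferentiableAt ℝ φ p := (hφ.differentiable (by norm_num)) p
  have hd2 : ∀ v : ℝ × ℝ, DifferentiableAt ℝ (fun w => fderiv ℝ φ w v) p := fun v =>
    (((hφ.fderiv_right (m := 1) (by norm_num)).clm_apply contDiff_const).differentiable
      (by norm_num)) p
  have hk : k0 m lam ^ 2 - k1 m lam ^ 2 = (m : ℂ) ^ 2 / 4 := by
    simp only [k0, k1]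
    field_simp
    ring
  have hsin : Real.sin (β * φ p)
      = 2 * Real.sin (β * φ p / 2) * Real.cos (β * φ p / 2) := by
    rw [← Real.sin_two_mul]
    congr 1
    ring
  have hm : (β : ℂ) * ((m ^ 2 / β : ℝ) : ℂ) = 4 * (k0 m lam ^ 2 - k1 m lam ^ 2) := by
    have : (β : ℂ) ≠ 0 := by exact_mod_cast hβ
    rw [hk]
    push_cast
    field_simp
  simp only [USG, VSG]
  rw [mderiv_lax _ _ _ _ _ _ _ _ hd (hd2 _), mderiv_lax _ _ _ _ _ _ _ _ hd (hd2 _), hsin]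
  generalize fderiv ℝ (fun w => fderiv ℝ φ w (0, 1)) p (0, 1) = ptt
  generalize fderiv ℝ (fun w => fderiv ℝ φ w (1, 0)) p (1, 0) = pxx
  generalize fderiv ℝ φ p (0, 1) = pt
  generalize fderiv ℝ φ p (1, 0) = px
  generalize Real.sin (β * φ p / 2) = s
  generalize Real.cos (β * φ p / 2) = c
  generalize m ^ 2 / β = q at *
  generalize k0 m lam = a at *
  generalize k1 m lam = b at *
  have hI : Complex.I ^ 2 = -1 := Complex.I_sq
  ext i j
  fin_cases i <;> fin_cases j <;>
    simp [σ1, σ2, σ3, Matrix.mul_apply, Fin.sum_univ_two, -Complex.ofReal_div, -Complex.ofReal_pow] <;>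
    generalize Complex.I = I at *
  · linear_combination (I * s * c / 2) * hm + (2 * s * c * I * (a ^ 2 - b ^ 2)) * hI
  · linear_combination (I * c * β * (b * px - a * pt) / 2) * hI
  · linear_combination (I * c * β * (b * px - a * pt) / 2) * hI
  · linear_combination -(I * s * c / 2) * hm - (2 * s * c * I * (a ^ 2 - b ^ 2)) * hI

/-- The zero curvature equation for the sine-Gordon Lax pair holds for all (x,t) and all
nonzero spectral parameters iff φ solves the sine-Gordon equation. -/
theorem sineGordon_zero_curvature_iff
    (m β : ℝ) (hβ : β ≠ 0) (φ : ℝ × ℝ → ℝ) (hφ : ContDiff ℝ 2 φ) :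
    (∀ p : ℝ × ℝ, ∀ lam : ℂ, lam ≠ 0 →
      mderiv (fun w => USG m β (φ w) (fderiv ℝ φ w (0, 1)) lam) p (0, 1)
        - mderiv (fun w => VSG m β (φ w) (fderiv ℝ φ w (1, 0)) lam) p (1, 0)
        + (USG m β (φ p) (fderiv ℝ φ p (0, 1)) lam * VSG m β (φ p) (fderiv ℝ φ p (1, 0)) lam
            - VSG m β (φ p) (fderiv ℝ φ p (1, 0)) lam * USG m β (φ p) (fderiv ℝ φ p (0, 1)) lam)
        = 0)
    ↔ (∀ p : ℝ × ℝ,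
        fderiv ℝ (fun w => fderiv ℝ φ w (0, 1)) p (0, 1)
          - fderiv ℝ (fun w => fderiv ℝ φ w (1, 0)) p (1, 0)
          + (m ^ 2 / β) * Real.sin (β * φ p) = 0) := by
  constructor
  · intro h p
    have h1 := h p 1 one_ne_zero
    rw [curv m β hβ φ hφ p 1 one_ne_zero] at h1
    have h2 := congrFun (congrFun h1 0) 0
    simp only [Matrix.smul_apply, σ3, Matrix.of_apply, Matrix.cons_val_zero, Matrix.cons_val',
      smul_eq_mul, mul_one, Matrix.zero_apply] at h2
    have hb : (β : ℂ) ≠ 0 := by exact_mod_cast hβ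
    have hne : -Complex.I * ((β : ℂ) / 4) ≠ 0 :=
      mul_ne_zero (neg_ne_zero.mpr Complex.I_ne_zero) (div_ne_zero hb (by norm_num))
    exact_mod_cast (mul_eq_zero.mp h2).resolve_left hne
  · intro h p lam hl
    rw [curv m β hβ φ hφ p lam hl, h p]
    simp
end
end

section
/- Let q, r : ℝ² → ℂ (coordinates (x,t)) be three times continuously differentiable. Define U(x,t;λ) = U(q(x,t), r(x,t); λ) and V(x,t;λ) = V(q(x,t), r(x,t), ∂_x q(x,t), ∂_x r(x,t), ∂_x²q(x,t), ∂_x²r(x,t); λ). Then the zero curvature equation ∂_t U(x,t;λ) − ∂_x V(x,t;λ) + [U(x,t;λ), V(x,t;λ)] = 0 holds for all (x,t) ∈ ℝ² and all λ ∈ ℂ if and only if q, r satisfy the modified Korteweg–de Vries system ∂_t q − ∂_x³q + 6qr·∂_x q = 0 and ∂_t r − ∂_x³r + 6qr·∂_x r = 0 on all of ℝ². -/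
noncomputable section

open Matrix

def σp : Matrix (Fin 2) (Fin 2) ℂ := !![0, 1; 0, 0]
def σm : Matrix (Fin 2) (Fin 2) ℂ := !![0, 0; 1, 0]

/-- AKNS space Lax matrix U(q, r; λ). -/
def Uak (q r lam : ℂ) : Matrix (Fin 2) (Fin 2) ℂ :=
  (-(Complex.I * lam) / 2) • σ3 + q • σp + r • σm

/-- mKdV time Lax matrix V(q, r, q_x, r_x, q_xx, r_xx; λ). -/
def VmKdV (q r qx rx qxx rxx lam : ℂ) : Matrix (Fin 2) (Fin 2) ℂ :=
  (-lam ^ 3 / (2 * Complex.I) + Complex.I * lam * q * r + rx * q - qx * r) • σ3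
    + (-lam ^ 2 * q - Complex.I * lam * qx + qxx - 2 * q ^ 2 * r) • σp
    + (-lam ^ 2 * r + Complex.I * lam * rx + rxx - 2 * q * r ^ 2) • σm

/-- x-derivative of a complex-valued function on ℝ², coordinates (x,t). -/
def dx (f : ℝ × ℝ → ℂ) (w : ℝ × ℝ) : ℂ := fderiv ℝ f w (1, 0)

/-- t-derivative of a complex-valued function on ℝ², coordinates (x,t). -/
def dt (f : ℝ × ℝ → ℂ) (w : ℝ × ℝ) : ℂ := fderiv ℝ f w (0, 1)

theorem contDiff_dx {f : ℝ × ℝ → ℂ} {m n : WithTop ℕ∞} (hf : ContDiff ℝ n f) (h : m + 1 ≤ n) :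
    ContDiff ℝ m (dx f) := by
  unfold dx
  exact (hf.fderiv_right h).clm_apply contDiff_const

theorem mderiv_Uak {q r : ℝ × ℝ → ℂ} {p : ℝ × ℝ} (v : ℝ × ℝ) (lam : ℂ) :
    mderiv (fun w => Uak (q w) (r w) lam) p v
      = !![0, fderiv ℝ q p v; fderiv ℝ r p v, 0] := by
  ext i j
  fin_cases i <;> fin_cases j <;> simp [mderiv, Uak, σ3, σp, σm]

theorem mderiv_VmKdV {q r a b c d : ℝ × ℝ → ℂ} {p : ℝ × ℝ} (v : ℝ × ℝ) (lam : ℂ)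
    (hq : DifferentiableAt ℝ q p) (hr : DifferentiableAt ℝ r p)
    (ha : DifferentiableAt ℝ a p) (hb : DifferentiableAt ℝ b p)
    (hc : DifferentiableAt ℝ c p) (hd : DifferentiableAt ℝ d p) :
    mderiv (fun w => VmKdV (q w) (r w) (a w) (b w) (c w) (d w) lam) p v
      = (Complex.I * lam * (fderiv ℝ q p v * r p + q p * fderiv ℝ r p v)
          + (fderiv ℝ b p v * q p + b p * fderiv ℝ q p v)
          - (fderiv ℝ a p v * r p + a p * fderiv ℝ r p v)) • σ3
        + (-lam ^ 2 * fderiv ℝ q p v - Complex.I * lam * fderiv ℝ a p v + fderiv ℝ c p v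
          - 2 * (2 * q p * fderiv ℝ q p v * r p + q p ^ 2 * fderiv ℝ r p v)) • σp
        + (-lam ^ 2 * fderiv ℝ r p v + Complex.I * lam * fderiv ℝ b p v + fderiv ℝ d p v
          - 2 * (2 * r p * fderiv ℝ r p v * q p + r p ^ 2 * fderiv ℝ q p v)) • σm := by
  have q' := hq.hasFDerivAt
  have r' := hr.hasFDerivAt
  have a' := ha.hasFDerivAt
  have b' := hb.hasFDerivAt
  have c' := hc.hasFDerivAt
  have d' := hd.hasFDerivAt
  have h3 := (((((q'.const_mul (Complex.I * lam)).mul r').const_add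
    (-lam ^ 3 / (2 * Complex.I))).add (b'.mul q')).sub (a'.mul r'))
  have hp := (((q'.const_mul (-lam ^ 2)).sub (a'.const_mul (Complex.I * lam))).add c').sub
    (((q'.pow 2).const_mul 2).mul r')
  have hm := (((r'.const_mul (-lam ^ 2)).add (b'.const_mul (Complex.I * lam))).add d').sub
    ((q'.const_mul 2).mul (r'.pow 2))
  ext i j
  fin_cases i <;> fin_cases j
  · have e : (fun w => VmKdV (q w) (r w) (a w) (b w) (c w) (d w) lam 0 0) = fun w =>
      -lam ^ 3 / (2 * Complex.I) + Complex.I * lam * q w * r w + b w * q w - a w * r w := by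
      funext w; simp [VmKdV, σ3, σp, σm]
    have := congrArg (fun L => L v) (HasFDerivAt.fderiv h3)
    simp [mderiv, e]
    refine (this.trans ?_)
    simp [σ3, σp, σm]; ring
  · have e : (fun w => VmKdV (q w) (r w) (a w) (b w) (c w) (d w) lam 0 1) = fun w =>
      -lam ^ 2 * q w - Complex.I * lam * a w + c w - 2 * q w ^ 2 * r w := by
      funext w; simp [VmKdV, σ3, σp, σm]
    have := congrArg (fun L => L v) (HasFDerivAt.fderiv hp)
    simp only [mderiv, Fin.zero_eta, Fin.mk_one, Matrix.of_apply, e]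
    refine (this.trans ?_)
    simp [σ3, σp, σm]; ring
  · have e : (fun w => VmKdV (q w) (r w) (a w) (b w) (c w) (d w) lam 1 0) = fun w =>
      -lam ^ 2 * r w + Complex.I * lam * b w + d w - 2 * q w * r w ^ 2 := by
      funext w; simp [VmKdV, σ3, σp, σm]
    have := congrArg (fun L => L v) (HasFDerivAt.fderiv hm)
    simp only [mderiv, Fin.zero_eta, Fin.mk_one, Matrix.of_apply, e]
    refine (this.trans ?_)
    simp [σ3, σp, σm]; ring
  · have e : (fun w => VmKdV (q w) (r w) (a w) (b w) (c w) (d w) lam 1 1) = fun w =>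
      -(-lam ^ 3 / (2 * Complex.I) + Complex.I * lam * q w * r w + b w * q w - a w * r w) := by
      funext w; simp [VmKdV, σ3, σp, σm]
    have := congrArg (fun L => L v) (HasFDerivAt.fderiv h3.neg)
    simp only [mderiv, Fin.mk_one, Matrix.of_apply, e]
    refine (this.trans ?_)
    simp [σ3, σp, σm]; ring

/-- The zero curvature equation for the mKdV Lax pair holds for all (x,t) and all
spectral parameters iff (q, r) solves the modified Korteweg–de Vries system. -/
theorem mkdv_zero_curvature_iff (q r : ℝ × ℝ → ℂ)
    (hq : ContDiff ℝ 3 q) (hr : ContDiff ℝ 3 r) :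
    (∀ p : ℝ × ℝ, ∀ lam : ℂ,
      mderiv (fun w => Uak (q w) (r w) lam) p (0, 1)
        - mderiv (fun w =>
            VmKdV (q w) (r w) (dx q w) (dx r w) (dx (dx q) w) (dx (dx r) w) lam) p (1, 0)
        + (Uak (q p) (r p) lam
              * VmKdV (q p) (r p) (dx q p) (dx r p) (dx (dx q) p) (dx (dx r) p) lam
            - VmKdV (q p) (r p) (dx q p) (dx r p) (dx (dx q) p) (dx (dx r) p) lam
              * Uak (q p) (r p) lam)
        = 0)
    ↔ (∀ p : ℝ × ℝ,
        dt q p - dx (dx (dx q)) p + 6 * q p * r p * dx q p = 0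
        ∧ dt r p - dx (dx (dx r)) p + 6 * q p * r p * dx r p = 0) := by
  have q1 : ContDiff ℝ 2 (dx q) := contDiff_dx hq (by norm_num)
  have r1 : ContDiff ℝ 2 (dx r) := contDiff_dx hr (by norm_num)
  have q2 : ContDiff ℝ 1 (dx (dx q)) := contDiff_dx q1 (by norm_num)
  have r2 : ContDiff ℝ 1 (dx (dx r)) := contDiff_dx r1 (by norm_num)
  have key : ∀ (p : ℝ × ℝ) (lam : ℂ),
      mderiv (fun w => Uak (q w) (r w) lam) p (0, 1)
        - mderiv (fun w =>
            VmKdV (q w) (r w) (dx q w) (dx r w) (dx (dx q) w) (dx (dx r) w) lam) p (1, 0)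
        + (Uak (q p) (r p) lam
              * VmKdV (q p) (r p) (dx q p) (dx r p) (dx (dx q) p) (dx (dx r) p) lam
            - VmKdV (q p) (r p) (dx q p) (dx r p) (dx (dx q) p) (dx (dx r) p) lam
              * Uak (q p) (r p) lam)
      = !![0, dt q p - dx (dx (dx q)) p + 6 * q p * r p * dx q p;
          dt r p - dx (dx (dx r)) p + 6 * q p * r p * dx r p, 0] := by
    intro p lam
    rw [mderiv_Uak, mderiv_VmKdV (1, 0) lam
      (hq.differentiable (by norm_num) p) (hr.differentiable (by norm_num) p)
      (q1.differentiable (by norm_num) p) (r1.differentiable (by norm_num) p)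
      (q2.differentiable (by norm_num) p) (r2.differentiable (by norm_num) p)]
    have hx : ∀ f : ℝ × ℝ → ℂ, fderiv ℝ f p (1, 0) = dx f p := fun _ => rfl
    have ht : ∀ f : ℝ × ℝ → ℂ, fderiv ℝ f p (0, 1) = dt f p := fun _ => rfl
    simp only [hx, ht]
    have hI : -lam ^ 3 / (2 * Complex.I) = Complex.I * lam ^ 3 / 2 := by
      have := Complex.I_ne_zero
      field_simp
      simp
    have hI2 := Complex.I_sq
    unfold VmKdV Uak
    rw [hI]
    ext i j
    fin_cases i <;> fin_cases j <;>
      simp [σ3, σp, σm, Matrix.mul_apply, Fin.sum_univ_two]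
    · ring
    · linear_combination (lam ^ 2 * dx q p) * hI2
    · linear_combination (lam ^ 2 * dx r p) * hI2
    · ring
  simp only [key]
  constructor
  · intro h p
    have h0 := h p 0
    exact ⟨by simpa using congrFun (congrFun h0 0) 1, by simpa using congrFun (congrFun h0 1) 0⟩
  · intro h p _
    rw [(h p).1, (h p).2]
    ext i j
    fin_cases i <;> fin_cases j <;> rfl
end
end

section
/- (Dual Sklyanin relation for the NLS time Lax matrix.) For all (q, r, q_x, r_x) ∈ ℂ⁴ and all λ, μ ∈ ℂ with λ ≠ μ, the 4×4 matrix identity {V₁(q,r,q_x,r_x;λ), V₂(q,r,q_x,r_x;μ)}_T = [r₁₂(λ,μ), V(q,r,q_x,r_x;λ)⊗I + I⊗V(q,r,q_x,r_x;μ)] holds, where r₁₂ is the rational classical r-matrix. -/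
noncomputable section

open Matrix Kronecker

def I2 : Matrix (Fin 2) (Fin 2) ℂ := 1

/-- NLS time Lax matrix as a function of (q, r, q_x, r_x) ∈ ℂ⁴. -/
def Vnls (lam : ℂ) (w : ℂ × ℂ × ℂ × ℂ) : Matrix (Fin 2) (Fin 2) ℂ :=
  (lam ^ 2 / (2 * Complex.I) - Complex.I * w.1 * w.2.1) • σ3
    + (lam * w.1 + Complex.I * w.2.2.1) • σp
    + (lam * w.2.1 - Complex.I * w.2.2.2) • σm

/-- single-time (time) Poisson bracket of functions of (q, r, q_x, r_x) ∈ ℂ⁴: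
{B,D}_T = (∂B/∂q)(∂D/∂r_x) − (∂D/∂q)(∂B/∂r_x) + (∂B/∂r)(∂D/∂q_x) − (∂D/∂r)(∂B/∂q_x). -/
def pbT (B D : ℂ × ℂ × ℂ × ℂ → ℂ) (p : ℂ × ℂ × ℂ × ℂ) : ℂ :=
  fderiv ℂ B p (1, 0, 0, 0) * fderiv ℂ D p (0, 0, 0, 1)
    - fderiv ℂ D p (1, 0, 0, 0) * fderiv ℂ B p (0, 0, 0, 1)
    + fderiv ℂ B p (0, 1, 0, 0) * fderiv ℂ D p (0, 0, 1, 0)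
    - fderiv ℂ D p (0, 1, 0, 0) * fderiv ℂ B p (0, 0, 1, 0)

/-- {M₁, N₂}: 4×4 matrix whose ((i,k),(j,l)) entry is the bracket of M_{ij} with N_{kl}. -/
def matPBT (M N : ℂ × ℂ × ℂ × ℂ → Matrix (Fin 2) (Fin 2) ℂ) (p : ℂ × ℂ × ℂ × ℂ) :
    Matrix (Fin 2 × Fin 2) (Fin 2 × Fin 2) ℂ :=
  Matrix.of fun ik jl => pbT (fun w => M w ik.1 jl.1) (fun w => N w ik.2 jl.2) p

/-- rational classical r-matrix. -/
def rRat (lam mu : ℂ) : Matrix (Fin 2 × Fin 2) (Fin 2 × Fin 2) ℂ :=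
  (1 / (mu - lam)) •
    (σp ⊗ₖ σm + σm ⊗ₖ σp + (1 / 2 : ℂ) • (σ3 ⊗ₖ σ3) + (1 / 2 : ℂ) • (I2 ⊗ₖ I2))

/-- General derivative of the scalar functions `a + b q r + c q + d r + e q_x + f r_x`. -/
theorem fderiv_aux (a b c d e f : ℂ) (p v : ℂ × ℂ × ℂ × ℂ) :
    fderiv ℂ (fun w : ℂ × ℂ × ℂ × ℂ =>
      a + b * (w.1 * w.2.1) + c * w.1 + d * w.2.1 + e * w.2.2.1 + f * w.2.2.2) p v
    = b * (p.1 * v.2.1 + p.2.1 * v.1) + c * v.1 + d * v.2.1 + e * v.2.2.1 + f * v.2.2.2 := by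
  have h1 : HasFDerivAt (fun w : ℂ × ℂ × ℂ × ℂ => w.1) (ContinuousLinearMap.fst ℂ ℂ (ℂ × ℂ × ℂ)) p :=
    hasFDerivAt_fst
  have h2' : HasFDerivAt (fun w : ℂ × ℂ × ℂ × ℂ => w.2) (ContinuousLinearMap.snd ℂ ℂ (ℂ × ℂ × ℂ)) p :=
    hasFDerivAt_snd
  have h2 := h2'.fst
  have h3 := h2'.snd.fst
  have h4 := h2'.snd.snd
  have H := ((((((h1.mul h2).const_mul b).const_add a).add (h1.const_mul c)).add
    (h2.const_mul d)).add (h3.const_mul e)).add (h4.const_mul f)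
  have H2 := H.fderiv
  have H3 := congrArg (fun L => L v) H2
  refine Eq.trans H3 ?_
  simp
  ring

theorem V00 (lam : ℂ) : (fun w => Vnls lam w 0 0) = fun w : ℂ × ℂ × ℂ × ℂ =>
    (lam ^ 2 / (2 * Complex.I)) + (-Complex.I) * (w.1 * w.2.1) + 0 * w.1 + 0 * w.2.1
      + 0 * w.2.2.1 + 0 * w.2.2.2 := by
  funext w; simp [Vnls, σ3, σp, σm]; ring

theorem V11 (lam : ℂ) : (fun w => Vnls lam w 1 1) = fun w : ℂ × ℂ × ℂ × ℂ =>
    (-(lam ^ 2 / (2 * Complex.I))) + Complex.I * (w.1 * w.2.1) + 0 * w.1 + 0 * w.2.1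
      + 0 * w.2.2.1 + 0 * w.2.2.2 := by
  funext w; simp [Vnls, σ3, σp, σm]; ring

theorem V01 (lam : ℂ) : (fun w => Vnls lam w 0 1) = fun w : ℂ × ℂ × ℂ × ℂ =>
    0 + 0 * (w.1 * w.2.1) + lam * w.1 + 0 * w.2.1
      + Complex.I * w.2.2.1 + 0 * w.2.2.2 := by
  funext w; simp [Vnls, σ3, σp, σm]

theorem V10 (lam : ℂ) : (fun w => Vnls lam w 1 0) = fun w : ℂ × ℂ × ℂ × ℂ =>
    0 + 0 * (w.1 * w.2.1) + 0 * w.1 + lam * w.2.1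
      + 0 * w.2.2.1 + (-Complex.I) * w.2.2.2 := by
  funext w; simp [Vnls, σ3, σp, σm]; ring

/-- Dual Sklyanin relation for the NLS time Lax matrix. -/
theorem sklyanin_NLS_V (q r qx rx : ℂ) (lam mu : ℂ) (h : lam ≠ mu) :
    matPBT (Vnls lam) (Vnls mu) (q, r, qx, rx)
      = rRat lam mu * (Vnls lam (q, r, qx, rx) ⊗ₖ I2 + I2 ⊗ₖ Vnls mu (q, r, qx, rx))
          - (Vnls lam (q, r, qx, rx) ⊗ₖ I2 + I2 ⊗ₖ Vnls mu (q, r, qx, rx)) * rRat lam mu := by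
  have hm : mu - lam ≠ 0 := sub_ne_zero.mpr (Ne.symm h)
  ext ⟨i, k⟩ ⟨j, l⟩
  fin_cases i <;> fin_cases k <;> fin_cases j <;> fin_cases l <;>
    simp only [matPBT, Matrix.of_apply, pbT, Fin.zero_eta, Fin.mk_one, V00, V01, V10, V11,
      fderiv_aux] <;>
    simp [rRat, Vnls, I2, σ3, σp, σm, Matrix.mul_apply, Fintype.sum_prod_type,
      Matrix.one_apply] <;>
    field_simp <;> ring_nf <;> simp only [Complex.I_sq] <;> ring_nf
end
end

section
/- (The covariant Hamiltonian flow of the sine-Gordon Lax form equals the commutator of the Lax pair.) For all real (φ, φ_t, φ_x) and all λ ∈ ℂ with λ ≠ 0, the 2×2 matrix identity [U(φ,φ_t;λ), V(φ,φ_x;λ)] = (iβ/2)(k₀(λ)φ_t − k₁(λ)φ_x) cos(βφ/2) σ₁ + (iβ/2)(k₀(λ)φ_x − k₁(λ)φ_t) sin(βφ/2) σ₂ − i(m²/4) sin(βφ) σ₃ holds. -/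
noncomputable section

open Matrix

/-- The covariant Hamiltonian flow of the sine-Gordon Lax form equals the commutator
of the Lax pair. -/
theorem commutator_SG (m β : ℝ) (hβ : β ≠ 0) (φ φt φx : ℝ) (lam : ℂ) (hlam : lam ≠ 0) :
    USG m β φ φt lam * VSG m β φ φx lam - VSG m β φ φx lam * USG m β φ φt lam
      = (Complex.I * (β / 2) * (k0 m lam * φt - k1 m lam * φx) * Real.cos (β * φ / 2)) • σ1
        + (Complex.I * (β / 2) * (k0 m lam * φx - k1 m lam * φt) * Real.sin (β * φ / 2)) • σ2
        + (-Complex.I * ((m : ℂ) ^ 2 / 4) * Real.sin (β * φ)) • σ3 := by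
  have hs : ((Real.sin (β * φ) : ℝ) : ℂ)
      = 2 * (Real.sin (β * φ / 2) : ℂ) * (Real.cos (β * φ / 2) : ℂ) := by
    have h := Real.sin_two_mul (β * φ / 2)
    rw [show 2 * (β * φ / 2) = β * φ by ring] at h
    rw [h]
    push_cast
    ring
  have hk : k0 m lam ^ 2 - k1 m lam ^ 2 = (m : ℂ) ^ 2 / 4 := by
    unfold k0 k1
    field_simp
    ring
  rw [hs, ← hk]
  unfold USG VSG
  generalize ((Real.sin (β * φ / 2) : ℝ) : ℂ) = s
  generalize ((Real.cos (β * φ / 2) : ℝ) : ℂ) = c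
  generalize k0 m lam = a
  generalize k1 m lam = b
  have hI : Complex.I ^ 2 = -1 := Complex.I_sq
  have hI3 : Complex.I ^ 3 = -Complex.I := by rw [pow_succ, hI]; ring
  ext i j
  fin_cases i <;> fin_cases j <;>
    simp [σ1, σ2, σ3, Matrix.mul_apply, Fin.sum_univ_two] <;> ring_nf <;>
    simp only [hI, hI3] <;> ring
end
end

section
/- (Classical Yang–Baxter equation for the trigonometric sine-Gordon r-matrix.) Fix β ∈ ℝ and let r(λ,μ) = f(λ,μ)(I⊗I − σ₃⊗σ₃) + g(λ,μ)(σ₁⊗σ₁ + σ₂⊗σ₂) with f(λ,μ) = −(β²/16)(λ²+μ²)/(λ²−μ²) and g(λ,μ) = (β²/8)λμ/(λ²−μ²), defined for λ² ≠ μ². Then for all λ, μ, ν ∈ ℂ with λ², μ², ν² pairwise distinct, the 8×8 matrix identity [r₁₃(λ,ν), r₂₃(μ,ν)] + [r₁₂(λ,μ), r₁₃(λ,ν)] + [r₁₂(λ,μ), r₂₃(μ,ν)] = 0 holds, where r₁₂(λ,μ), r₁₃(λ,ν), r₂₃(μ,ν) denote the embeddings of the corresponding 4×4 matrices into the triple tensor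 product acting on factors (1,2), (1,3) and (2,3) respectively. -/
noncomputable section

open Matrix Kronecker

/-- trigonometric sine-Gordon classical r-matrix. -/
def rSG (β : ℝ) (lam mu : ℂ) : Matrix (Fin 2 × Fin 2) (Fin 2 × Fin 2) ℂ :=
  (-((β : ℂ) ^ 2 / 16) * (lam ^ 2 + mu ^ 2) / (lam ^ 2 - mu ^ 2)) • (I2 ⊗ₖ I2 - σ3 ⊗ₖ σ3)
    + (((β : ℂ) ^ 2 / 8) * lam * mu / (lam ^ 2 - mu ^ 2)) • (σ1 ⊗ₖ σ1 + σ2 ⊗ₖ σ2)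

/-- index set of the triple tensor product -/
abbrev Idx3 := Fin 2 × Fin 2 × Fin 2

/-- embedding of a 4×4 matrix acting on tensor factors (1,2). -/
def emb12 (s : Matrix (Fin 2 × Fin 2) (Fin 2 × Fin 2) ℂ) : Matrix Idx3 Idx3 ℂ :=
  Matrix.of fun p q => if p.2.2 = q.2.2 then s (p.1, p.2.1) (q.1, q.2.1) else 0

/-- embedding of a 4×4 matrix acting on tensor factors (1,3). -/
def emb13 (s : Matrix (Fin 2 × Fin 2) (Fin 2 × Fin 2) ℂ) : Matrix Idx3 Idx3 ℂ :=
  Matrix.of fun p q => if p.2.1 = q.2.1 then s (p.1, p.2.2) (q.1, q.2.2) else 0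

/-- embedding of a 4×4 matrix acting on tensor factors (2,3). -/
def emb23 (s : Matrix (Fin 2 × Fin 2) (Fin 2 × Fin 2) ℂ) : Matrix Idx3 Idx3 ℂ :=
  Matrix.of fun p q => if p.1 = q.1 then s p.2 q.2 else 0

/-- Diagonal/off-diagonal form of the r-matrix. -/
theorem rSG_apply (β : ℝ) (x y : ℂ) (a b c d : Fin 2) :
    rSG β x y (a, b) (c, d) =
      if a = b then 0 else
      if a = c ∧ b = d then -((β : ℂ) ^ 2 / 8) * (x ^ 2 + y ^ 2) / (x ^ 2 - y ^ 2) else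
      if a = d ∧ b = c then ((β : ℂ) ^ 2 / 4) * x * y / (x ^ 2 - y ^ 2) else 0 := by
  fin_cases a <;> fin_cases b <;> fin_cases c <;> fin_cases d <;>
    simp [rSG, σ1, σ2, σ3, I2] <;> ring

/-- Classical Yang–Baxter equation for the trigonometric sine-Gordon r-matrix. -/
theorem cybe_trigonometric (β : ℝ) (lam mu nu : ℂ)
    (h1 : lam ^ 2 ≠ mu ^ 2) (h2 : lam ^ 2 ≠ nu ^ 2) (h3 : mu ^ 2 ≠ nu ^ 2) :
    (emb13 (rSG β lam nu) * emb23 (rSG β mu nu) - emb23 (rSG β mu nu) * emb13 (rSG β lam nu))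
      + (emb12 (rSG β lam mu) * emb13 (rSG β lam nu)
          - emb13 (rSG β lam nu) * emb12 (rSG β lam mu))
      + (emb12 (rSG β lam mu) * emb23 (rSG β mu nu)
          - emb23 (rSG β mu nu) * emb12 (rSG β lam mu)) = 0 := by
  have e1 := sub_ne_zero.mpr h1
  have e2 := sub_ne_zero.mpr h2
  have e3 := sub_ne_zero.mpr h3
  ext ⟨a, b, c⟩ ⟨p, q, r⟩
  simp only [Matrix.add_apply, Matrix.sub_apply, Matrix.mul_apply, Fintype.sum_prod_type,
    Fin.sum_univ_two, emb12, emb13, emb23, Matrix.of_apply, rSG_apply, Matrix.zero_apply]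
  fin_cases a <;> fin_cases b <;> fin_cases c <;> fin_cases p <;> fin_cases q <;>
    fin_cases r <;> simp <;> field_simp <;> ring
end
end
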